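/- arXiv:0709.0243 — 2 statements merged into one kernel-verified Lean document; each statement's English description precedes it below -/
import Mathlib

section
/- Let 0 < a ≤ 1, c > 0, 1 < p < ∞ and ν > −1/p, and define the weight w on [0,1] by w(t) = c·(t/a)^ν for 0 ≤ t ≤ a and w(t) = c for a ≤ t ≤ 1. Then the reverse-Hölder p-constant of w equals (1 + ν)/(pν + 1)^{1/p}; that is, sup over all subintervals J ⊂ [0,1] of ⟨w^p⟩_J^{1/p} / ⟨w⟩_J is exactly (1 + ν)/(pν + 1)^{1/p}, and this supremum is attained at J = [0, a]. -/
open MeasureTheory Set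

/-- The average `⟨f⟩_{(a,b)}` of a real-valued function over an interval. -/
noncomputable def avgR (f : ℝ → ℝ) (a b : ℝ) : ℝ :=
  (∫ t in Set.Ioo a b, f t) / (b - a)

theorem avgR_congr {f g : ℝ → ℝ} {α β : ℝ} (h : EqOn f g (Ioo α β)) :
    avgR f α β = avgR g α β := by
  unfold avgR
  rw [setIntegral_congr_fun measurableSet_Ioo h]

theorem avgR_const {α β : ℝ} (h : α < β) (k : ℝ) : avgR (fun _ => k) α β = k := by
  have : β - α ≠ 0 := by linarith
  simp [avgR, h.le, this]

theorem avgR_power_then_const {k m μ α β : ℝ} (hμ : -1 < μ) (hα : 0 ≤ α) (hm : α < m)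
    (hβ : m ≤ β) :
    avgR (fun t => if t ≤ m then k * (t / m) ^ μ else k) α β
      = k * (1 - (α / m) ^ (μ + 1) + (μ + 1) * ((β - m) / m))
        / ((1 - α / m + (β - m) / m) * (μ + 1)) := by
  have hm0 : 0 < m := hα.trans_lt hm
  have hμ1 : μ + 1 ≠ 0 := by linarith
  have left_eq : EqOn (fun t => k * (t / m) ^ μ)
      (fun t => if t ≤ m then k * (t / m) ^ μ else k) (uIoc α m) := by
    intro t ht
    rw [uIoc_of_le hm.le] at ht
    simp [ht.2]
  have right_eq : EqOn (fun _ => k)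
      (fun t => if t ≤ m then k * (t / m) ^ μ else k) (uIoc m β) := by
    intro t ht
    rw [uIoc_of_le hβ] at ht
    simp [not_le.mpr ht.1]
  have left_int : IntervalIntegrable (fun t => k * (t / m) ^ μ) volume α m := by
    refine IntervalIntegrable.const_mul ?_ k
    have := (intervalIntegral.intervalIntegrable_rpow' (a := α) (b := m) hμ).div_const (m ^ μ)
    refine this.congr fun t ht => ?_
    rw [uIoc_of_le hm.le] at ht
    exact (Real.div_rpow (hα.trans ht.1.le) hm0.le μ).symm
  have left_val : ∫ t in α..m, k * (t / m) ^ μ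
      = k * (m * ((1 - (α / m) ^ (μ + 1)) / (μ + 1))) := by
    rw [intervalIntegral.integral_const_mul,
      intervalIntegral.integral_comp_div (fun t => t ^ μ) hm0.ne', integral_rpow (Or.inl hμ),
      div_self hm0.ne', Real.one_rpow, smul_eq_mul]
  have hlen : 1 - α / m + (β - m) / m = (β - α) / m := by field_simp; ring
  have hβα : β - α ≠ 0 := by linarith
  rw [avgR, ← integral_Ioc_eq_integral_Ioo, ← intervalIntegral.integral_of_le (hm.le.trans hβ),
    ← intervalIntegral.integral_add_adjacent_intervals (b := m) (left_int.congr left_eq)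
      (intervalIntegrable_const.congr right_eq),
    ← intervalIntegral.integral_congr_ae (.of_forall left_eq),
    ← intervalIntegral.integral_congr_ae (.of_forall right_eq), left_val, intervalIntegral.integral_const,
    smul_eq_mul, hlen]
  field_simp

theorem rpow_ite_power_const {k m p ν t : ℝ} (hk : 0 ≤ k) (hm : 0 ≤ m) (ht : 0 ≤ t) :
    (if t ≤ m then k * (t / m) ^ ν else k) ^ p
      = if t ≤ m then k ^ p * (t / m) ^ (p * ν) else k ^ p := by
  have h := div_nonneg ht hm
  split_ifs
  · rw [Real.mul_rpow hk (Real.rpow_nonneg h _), ← Real.rpow_mul h, mul_comm ν]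
  · rfl

theorem rpow_mul_rpow_le_of_add {p ν x s : ℝ} (hp : 1 < p) (hν : 0 < p * ν + 1) (hx0 : 0 ≤ x)
    (hx1 : x ≤ 1) (hs : 0 ≤ s) :
    (1 - x ^ (p * ν + 1) + (p * ν + 1) * s) ^ (1 / p) * (1 - x + s) ^ (1 - 1 / p)
      ≤ 1 - x ^ (ν + 1) + (ν + 1) * s := by
  have hp0 : 0 < p := by linarith
  have hq : 0 < 1 - 1 / p := sub_pos.mpr ((div_lt_one hp0).mpr hp)
  have hu1 : x ^ (p * ν + 1) ≤ 1 := Real.rpow_le_one hx0 hx1 hν.le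
  have hu0 : 0 ≤ x ^ (p * ν + 1) := Real.rpow_nonneg hx0 _
  have hsum : 1 / p + (1 - 1 / p) = 1 := by ring
  have hA : 0 ≤ 1 - x ^ (p * ν + 1) + (p * ν + 1) * s := by nlinarith [mul_nonneg hν.le hs]
  have hAB := Real.geom_mean_le_arith_mean2_weighted (by positivity) hq.le hA
    (show 0 ≤ 1 - x + s by linarith) hsum
  have huv := Real.geom_mean_le_arith_mean2_weighted (by positivity) hq.le hu0 hx0 hsum
  have hexp : (p * ν + 1) * (1 / p) + (1 - 1 / p) = ν + 1 := by field_simp; ring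
  have hν1 : 0 < ν + 1 := by rw [← hexp]; positivity
  rw [← Real.rpow_mul hx0, ← Real.rpow_add' hx0 (by rw [hexp]; exact hν1.ne'), hexp] at huv
  have htot : 1 / p * (1 - x ^ (p * ν + 1) + (p * ν + 1) * s) + (1 - 1 / p) * (1 - x + s)
      + (1 / p * x ^ (p * ν + 1) + (1 - 1 / p) * x) = 1 + (ν + 1) * s := by
    field_simp; ring
  linarith

theorem avgR_rpow_le_power_then_const {k m p ν α β : ℝ} (hk : 0 ≤ k) (hp : 1 < p)
    (hν : 0 < p * ν + 1) (hα : 0 ≤ α) (hm : α < m) (hβ : m ≤ β) :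
    (avgR (fun t => (if t ≤ m then k * (t / m) ^ ν else k) ^ p) α β) ^ (1 / p)
      ≤ ((1 + ν) / (p * ν + 1) ^ (1 / p)) *
        avgR (fun t => if t ≤ m then k * (t / m) ^ ν else k) α β := by
  have hm0 : 0 < m := hα.trans_lt hm
  have hp0 : 0 < p := by linarith
  have hν1 : 0 < 1 + ν := by nlinarith
  have hx0 : 0 ≤ α / m := by positivity
  have hx1 : α / m < 1 := (div_lt_one hm0).mpr hm
  have hs : 0 ≤ (β - m) / m := div_nonneg (by linarith) hm0.le
  rw [avgR_congr (fun t ht => rpow_ite_power_const hk hm0.le (hα.trans ht.1.le)),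
    avgR_power_then_const (by linarith) hα hm hβ, avgR_power_then_const (by linarith) hα hm hβ]
  have key := rpow_mul_rpow_le_of_add hp hν hx0 hx1.le hs
  have hA : 0 ≤ 1 - (α / m) ^ (p * ν + 1) + (p * ν + 1) * ((β - m) / m) := by
    have := Real.rpow_le_one hx0 hx1.le hν.le
    nlinarith [mul_nonneg hν.le hs]
  have hB : 0 < 1 - α / m + (β - m) / m := by linarith
  generalize 1 - (α / m) ^ (p * ν + 1) + (p * ν + 1) * ((β - m) / m) = A at *
  generalize 1 - (α / m) ^ (ν + 1) + (ν + 1) * ((β - m) / m) = E at *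
  generalize 1 - α / m + (β - m) / m = B at *
  rw [Real.rpow_sub hB, Real.rpow_one] at key
  rw [Real.div_rpow (by positivity) (by positivity), Real.mul_rpow (by positivity) hA,
    Real.mul_rpow hB.le hν.le, ← Real.rpow_mul hk, mul_one_div_cancel hp0.ne', Real.rpow_one]
  have hBp : 0 < B ^ (1 / p) := by positivity
  have hNp : 0 < (p * ν + 1) ^ (1 / p) := by positivity
  calc k * A ^ (1 / p) / (B ^ (1 / p) * (p * ν + 1) ^ (1 / p))
      = k / (B * (p * ν + 1) ^ (1 / p)) * (A ^ (1 / p) * (B / B ^ (1 / p))) := by field_simp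
    _ ≤ k / (B * (p * ν + 1) ^ (1 / p)) * E := by gcongr
    _ = _ := by rw [add_comm ν 1]; field_simp

theorem avgR_rpow_eq_power {k m p ν : ℝ} (hk : 0 ≤ k) (hm : 0 < m) (hp : 1 < p)
    (hν : 0 < p * ν + 1) :
    (avgR (fun t => (if t ≤ m then k * (t / m) ^ ν else k) ^ p) 0 m) ^ (1 / p)
      = ((1 + ν) / (p * ν + 1) ^ (1 / p)) *
        avgR (fun t => if t ≤ m then k * (t / m) ^ ν else k) 0 m := by
  have hp0 : 0 < p := by linarith
  have hν1 : 0 < 1 + ν := by nlinarith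
  have hν1' : ν + 1 ≠ 0 := by linarith
  rw [avgR_congr (fun t ht => rpow_ite_power_const hk hm.le ht.1.le),
    avgR_power_then_const (by linarith) le_rfl hm le_rfl,
    avgR_power_then_const (by linarith) le_rfl hm le_rfl]
  simp only [zero_div, sub_self, Real.zero_rpow hν.ne', Real.zero_rpow hν1', mul_zero, add_zero,
    sub_zero, mul_one, one_mul]
  rw [Real.div_rpow (by positivity) hν.le, ← Real.rpow_mul hk, mul_one_div_cancel hp0.ne',
    Real.rpow_one, add_comm ν 1]
  field_simp

theorem one_le_power_weight_constant {p ν : ℝ} (hp : 1 < p) (hν : 0 < p * ν + 1) :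
    1 ≤ (1 + ν) / (p * ν + 1) ^ (1 / p) := by
  have hp0 : 0 < p := by linarith
  have h := Real.geom_mean_le_arith_mean2_weighted (w₁ := 1 / p) (w₂ := 1 - 1 / p) (by positivity)
    (sub_nonneg.mpr ((div_le_one hp0).mpr hp.le)) hν.le zero_le_one (by ring)
  have hmean : 1 / p * (p * ν + 1) + (1 - 1 / p) * 1 = 1 + ν := by field_simp; ring
  rwa [Real.one_rpow, mul_one, hmean, ← one_le_div (by positivity)] at h

theorem statement18 (a c p ν : ℝ) (ha0 : 0 < a) (ha1 : a ≤ 1) (hc : 0 < c)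
    (hp : 1 < p) (hν : -(1 / p) < ν) :
    (∀ α β : ℝ, 0 ≤ α → α < β → β ≤ 1 →
      (avgR (fun t => (if t ≤ a then c * (t / a) ^ ν else c) ^ p) α β) ^ (1 / p)
        ≤ ((1 + ν) / (p * ν + 1) ^ (1 / p)) *
          avgR (fun t => if t ≤ a then c * (t / a) ^ ν else c) α β) ∧
    (avgR (fun t => (if t ≤ a then c * (t / a) ^ ν else c) ^ p) 0 a) ^ (1 / p)
      = ((1 + ν) / (p * ν + 1) ^ (1 / p)) *
        avgR (fun t => if t ≤ a then c * (t / a) ^ ν else c) 0 a := by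
  have hp0 : 0 < p := by linarith
  have hN : 0 < p * ν + 1 := by
    have := mul_lt_mul_of_pos_left hν hp0
    rw [mul_neg, mul_one_div_cancel hp0.ne'] at this
    linarith
  refine ⟨fun α β hα hαβ _ => ?_, avgR_rpow_eq_power hc.le ha0 hp hN⟩
  rcases le_or_gt a α with haα | hαa
  · have hw : EqOn (fun t => if t ≤ a then c * (t / a) ^ ν else c) (fun _ => c) (Ioo α β) :=
      fun t ht => if_neg (not_le.mpr (haα.trans_lt ht.1))
    rw [avgR_congr hw, avgR_congr (fun t ht => congrArg (· ^ p) (hw ht)), avgR_const hαβ,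
      avgR_const hαβ, ← Real.rpow_mul hc.le, mul_one_div_cancel hp0.ne', Real.rpow_one]
    exact le_mul_of_one_le_left hc.le (one_le_power_weight_constant hp hN)
  rcases le_or_gt a β with haβ | hβa
  · exact avgR_rpow_le_power_then_const hc.le hp hN hα hαa haβ
  · have hβ0 : 0 < β := hα.trans_lt hαβ
    have hw : EqOn (fun t => if t ≤ a then c * (t / a) ^ ν else c)
        (fun t => if t ≤ β then c * (β / a) ^ ν * (t / β) ^ ν else c * (β / a) ^ ν)
        (Ioo α β) := by
      intro t ht
      have ht0 : 0 ≤ t := hα.trans ht.1.le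
      simp only [if_pos ht.2.le, if_pos (ht.2.le.trans hβa.le)]
      rw [mul_assoc, ← Real.mul_rpow (by positivity) (by positivity)]
      congr 2
      field_simp
    rw [avgR_congr hw, avgR_congr (fun t ht => congrArg (· ^ p) (hw ht))]
    exact avgR_rpow_le_power_then_const (by positivity) hp hN hα hαβ le_rfl
end

section
/- Let 0 < a ≤ 1, c > 0 and ν > 0, and define the weight w on [0,1] by w(t) = c·(t/a)^ν for 0 ≤ t ≤ a and w(t) = c for a ≤ t ≤ 1. Then the reverse-Hölder ∞-constant of w equals ν + 1; that is, sup over all subintervals J ⊂ [0,1] of (ess sup_J w) / ⟨w⟩_J is exactly ν + 1. -/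
open MeasureTheory Set ENNReal

/-- The weight equal to `c * (t / a) ^ ν` up to `a` and to `c` afterwards. -/
noncomputable def truncatedPower (a c ν t : ℝ) : ℝ :=
  if t ≤ a then c * (t / a) ^ ν else c

theorem truncatedPower_mono {a c ν s t : ℝ} (ha : 0 < a) (hc : 0 < c) (hν : 0 < ν)
    (hs : 0 ≤ s) (hst : s ≤ t) : truncatedPower a c ν s ≤ truncatedPower a c ν t := by
  unfold truncatedPower
  split_ifs with h1 h2 h2
  · gcongr
  · have : (s / a) ^ ν ≤ 1 :=
      Real.rpow_le_one (by positivity) ((div_le_one ha).2 h1) hν.le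
    nlinarith
  · linarith
  · exact le_rfl

theorem truncatedPower_nonneg {a c ν t : ℝ} (ha : 0 < a) (hc : 0 < c) (ht : 0 ≤ t) :
    0 ≤ truncatedPower a c ν t := by
  unfold truncatedPower
  split_ifs <;> positivity

theorem truncatedPower_mul_le {a c ν t b : ℝ} (ha : 0 < a) (hc : 0 < c) (hν : 0 < ν)
    (ht : 0 ≤ t) (htb : t ≤ b) (hb : 0 < b) :
    truncatedPower a c ν b * (t / b) ^ ν ≤ truncatedPower a c ν t := by
  have h1 : (t / b) ^ ν ≤ 1 :=
    Real.rpow_le_one (by positivity) ((div_le_one hb).2 htb) hν.le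
  unfold truncatedPower
  split_ifs with h2 h3 h3
  · rw [mul_assoc, ← Real.mul_rpow (by positivity) (by positivity)]
    refine le_of_eq ?_
    congr 2
    field_simp
  · linarith
  · have : t / b ≤ t / a := by gcongr; linarith
    gcongr
  · nlinarith

theorem integral_Ioo_div_rpow {α β ν : ℝ} (hβ : 0 < β) (hα : 0 ≤ α) (h : α ≤ β) (hν : 0 < ν) :
    ∫ t in Ioo α β, (t / β) ^ ν = (β - α * (α / β) ^ ν) / (ν + 1) := by
  have hpow : ∀ x : ℝ, 0 ≤ x → x ^ (ν + 1) = x * x ^ ν := fun x hx => by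
    rw [Real.rpow_add_of_nonneg hx hν.le zero_le_one, Real.rpow_one, mul_comm]
  rw [← integral_Ioc_eq_integral_Ioo, ← intervalIntegral.integral_of_le h,
    intervalIntegral.integral_comp_div (fun x => x ^ ν) hβ.ne',
    integral_rpow (Or.inl (by linarith)), div_self hβ.ne', Real.one_rpow, smul_eq_mul,
    hpow _ (by positivity)]
  field_simp

theorem integrableOn_truncatedPower {a c ν α β : ℝ} (ha : 0 < a) (hc : 0 < c) (hν : 0 < ν)
    (hα : 0 ≤ α) : IntegrableOn (truncatedPower a c ν) (Ioo α β) := by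
  have hmono : MonotoneOn (truncatedPower a c ν) (Icc α β) := fun s hs t _ hst =>
    truncatedPower_mono ha hc hν (hα.trans hs.1) hst
  exact (hmono.integrableOn_isCompact isCompact_Icc).mono_set Ioo_subset_Icc_self

theorem truncatedPower_le_avgR {a c ν α β : ℝ} (ha : 0 < a) (hc : 0 < c) (hν : 0 < ν)
    (hα : 0 ≤ α) (h : α < β) :
    truncatedPower a c ν β ≤ (ν + 1) * avgR (truncatedPower a c ν) α β := by
  have hβ : 0 < β := hα.trans_lt h
  have hint : ∫ t in Ioo α β, truncatedPower a c ν β * (t / β) ^ ν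
      ≤ ∫ t in Ioo α β, truncatedPower a c ν t := by
    refine setIntegral_mono_on ?_ (integrableOn_truncatedPower ha hc hν hα) measurableSet_Ioo
      fun t ht => truncatedPower_mul_le ha hc hν (hα.trans ht.1.le) ht.2.le hβ
    have hcont : Continuous fun t : ℝ => truncatedPower a c ν β * (t / β) ^ ν :=
      continuous_const.mul ((continuous_id.div_const β).rpow_const fun _ => Or.inr hν.le)
    exact (hcont.integrableOn_Icc).mono_set Ioo_subset_Icc_self
  rw [integral_const_mul, integral_Ioo_div_rpow hβ hα h.le hν] at hint
  have hw := truncatedPower_nonneg (ν := ν) ha hc hβ.le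
  have h1 : (α / β) ^ ν ≤ 1 :=
    Real.rpow_le_one (by positivity) ((div_le_one hβ).2 h.le) hν.le
  have h2 : truncatedPower a c ν β * (β - α)
      ≤ truncatedPower a c ν β * (β - α * (α / β) ^ ν) := by
    refine mul_le_mul_of_nonneg_left ?_ hw
    nlinarith
  rw [avgR, ← mul_div_assoc, le_div_iff₀ (sub_pos.2 h)]
  rw [← mul_div_assoc, div_le_iff₀ (by linarith)] at hint
  linarith

theorem avgR_truncatedPower {a c ν : ℝ} (ha : 0 < a) (hν : 0 < ν) :
    avgR (truncatedPower a c ν) 0 a = c / (ν + 1) := by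
  have heq : ∫ t in Ioo 0 a, truncatedPower a c ν t = ∫ t in Ioo 0 a, c * (t / a) ^ ν :=
    setIntegral_congr_fun measurableSet_Ioo fun t ht => if_pos ht.2.le
  rw [avgR, heq, integral_const_mul, integral_Ioo_div_rpow ha le_rfl ha.le hν]
  rw [zero_mul, sub_zero]
  field_simp

theorem ofReal_le_essSup_truncatedPower {a c ν : ℝ} (ha : 0 < a) (hc : 0 < c) (hν : 0 < ν) :
    ENNReal.ofReal c
      ≤ essSup (fun t => ENNReal.ofReal (truncatedPower a c ν t)) (volume.restrict (Ioo 0 a)) := by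
  set M := essSup (fun t => ENNReal.ofReal (truncatedPower a c ν t)) (volume.restrict (Ioo 0 a))
  have hae : ∀ᵐ t ∂volume.restrict (Ioo 0 a), ENNReal.ofReal (truncatedPower a c ν t) ≤ M :=
    ENNReal.ae_le_essSup _
  have hle : ∀ r ∈ Ioo 0 a, ENNReal.ofReal (c * (r / a) ^ ν) ≤ M := by
    intro r hr
    have hne : (volume.restrict (Ioo r a)) ≠ 0 := by
      rw [Ne, Measure.restrict_eq_zero, Real.volume_Ioo, ENNReal.ofReal_eq_zero]
      linarith [hr.2]
    have : (ae (volume.restrict (Ioo r a))).NeBot := ae_neBot.2 hne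
    have hae' := ae_restrict_of_ae_restrict_of_subset (Ioo_subset_Ioo_left hr.1.le) hae
    obtain ⟨t, ht, hrt⟩ := (hae'.and (ae_restrict_mem measurableSet_Ioo)).exists
    refine le_trans (ENNReal.ofReal_le_ofReal ?_) ht
    have := truncatedPower_mono ha hc hν hr.1.le hrt.1.le
    rwa [truncatedPower, if_pos hr.2.le] at this
  have hcont : Continuous fun r : ℝ => ENNReal.ofReal (c * (r / a) ^ ν) :=
    ENNReal.continuous_ofReal.comp
      (continuous_const.mul ((continuous_id.div_const a).rpow_const fun _ => Or.inr hν.le))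
  have hlim := (hcont.tendsto a).mono_left (nhdsWithin_le_nhds (s := Iio a))
  simp only [div_self ha.ne', Real.one_rpow, mul_one] at hlim
  exact le_of_tendsto hlim (Filter.eventually_of_mem (Ioo_mem_nhdsLT ha) hle)

theorem statement19 (a c ν : ℝ) (ha0 : 0 < a) (ha1 : a ≤ 1) (hc : 0 < c)
    (hν : 0 < ν) :
    (∀ α β : ℝ, 0 ≤ α → α < β → β ≤ 1 →
      essSup (fun t => ENNReal.ofReal (if t ≤ a then c * (t / a) ^ ν else c))
          (volume.restrict (Set.Ioo α β))
        ≤ ENNReal.ofReal ((ν + 1) *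
            avgR (fun t => if t ≤ a then c * (t / a) ^ ν else c) α β)) ∧
    (∀ C : ℝ, (∀ α β : ℝ, 0 ≤ α → α < β → β ≤ 1 →
        essSup (fun t => ENNReal.ofReal (if t ≤ a then c * (t / a) ^ ν else c))
            (volume.restrict (Set.Ioo α β))
          ≤ ENNReal.ofReal (C *
              avgR (fun t => if t ≤ a then c * (t / a) ^ ν else c) α β)) →
      ν + 1 ≤ C) := by
  refine ⟨fun α β hα h _ => ?_, fun C hC => ?_⟩
  · refine essSup_le_of_ae_le _ ?_
    filter_upwards [ae_restrict_mem measurableSet_Ioo] with t ht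
    exact ENNReal.ofReal_le_ofReal
      ((truncatedPower_mono ha0 hc hν (hα.trans ht.1.le) ht.2.le).trans
        (truncatedPower_le_avgR ha0 hc hν hα h))
  · have h := (ofReal_le_essSup_truncatedPower ha0 hc hν).trans (hC 0 a le_rfl ha0 ha1)
    change _ ≤ ENNReal.ofReal (C * avgR (truncatedPower a c ν) 0 a) at h
    rw [avgR_truncatedPower ha0 hν, ENNReal.ofReal_le_ofReal_iff',
      or_iff_left (not_le.2 hc), ← mul_div_assoc, le_div_iff₀ (by linarith), mul_comm] at h
    exact le_of_mul_le_mul_right h hc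
end
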